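/- arXiv:2204.08436 — 9 statements merged into one kernel-verified Lean document; each statement's English description precedes it below -/
import Mathlib

section
/- Every φ-metric space (X, d_φ, φ) equipped with the topology τ_φ is regular: for every τ_φ-closed set A ⊆ X and every point x ∈ X \ A, there exist disjoint τ_φ-open sets U and V such that A ⊆ U and x ∈ V. -/
open Filter Topology Set

/-- A φ-metric on a set `X`: a pair of functions `d : X × X → ℝ≥0` and
`phi : X × X × X → ℝ≥0` satisfying the axioms (d1)–(d3) and (φ1)–(φ3). -/
structure PhiMetric (X : Type*) where
  d : X → X → ℝ
  phi : X → X → X → ℝ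
  d_nonneg : ∀ x y, 0 ≤ d x y
  phi_nonneg : ∀ x y z, 0 ≤ phi x y z
  /-- (d1) -/
  d_eq_zero_iff : ∀ x y, d x y = 0 ↔ x = y
  /-- (d2) -/
  d_symm : ∀ x y, d x y = d y x
  /-- (d3) -/
  d_triangle : ∀ x y z, d x y ≤ d x z + d z y + phi x y z
  /-- (φ1) -/
  phi_eq_zero : ∀ x y z, x = z ∨ y = z → phi x y z = 0
  /-- (φ2) -/
  phi_symm : ∀ x y z, phi x y z = phi y x z
  /-- (φ3) -/
  phi_small : ∀ ε : ℝ, 0 < ε → ∃ δ : ℝ, 0 < δ ∧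
    ∀ x y z, (d x z < δ ∨ d y z < δ) → phi x y z < ε

namespace PhiMetric

variable {X : Type*}

/-- The open ball `B_φ(x, r)`. -/
def ball (M : PhiMetric X) (x : X) (r : ℝ) : Set X := {y | M.d x y < r}

/-- The topology `τ_φ` generated by a φ-metric:
`G` is open iff every point of `G` has an open ball around it inside `G`. -/
def toTopology (M : PhiMetric X) : TopologicalSpace X where
  IsOpen G := ∀ x ∈ G, ∃ r > 0, M.ball x r ⊆ G
  isOpen_univ := fun x _ => ⟨1, one_pos, fun y _ => Set.mem_univ y⟩
  isOpen_inter := by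
    intro s t hs ht x hx
    obtain ⟨r1, hr1, h1⟩ := hs x hx.1
    obtain ⟨r2, hr2, h2⟩ := ht x hx.2
    refine ⟨min r1 r2, lt_min hr1 hr2, fun y hy => ⟨h1 ?_, h2 ?_⟩⟩
    · have hy' : M.d x y < min r1 r2 := hy
      exact lt_of_lt_of_le hy' (min_le_left _ _)
    · have hy' : M.d x y < min r1 r2 := hy
      exact lt_of_lt_of_le hy' (min_le_right _ _)
  isOpen_sUnion := by
    intro S hS x hx
    obtain ⟨s, hs, hxs⟩ := hx
    obtain ⟨r, hr, hb⟩ := hS s hs x hxs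
    exact ⟨r, hr, fun y hy => ⟨s, hs, hb hy⟩⟩

/-- A sequence is Cauchy with respect to a φ-metric. -/
def IsCauchySeq (M : PhiMetric X) (u : ℕ → X) : Prop :=
  ∀ ε : ℝ, 0 < ε → ∃ N : ℕ, ∀ m ≥ N, ∀ n ≥ N, M.d (u m) (u n) < ε

/-- A φ-metric space is complete if every Cauchy sequence converges. -/
def Complete (M : PhiMetric X) : Prop :=
  ∀ u : ℕ → X, M.IsCauchySeq u →
    ∃ a : X, Filter.Tendsto (fun n => M.d (u n) a) Filter.atTop (nhds 0)

end PhiMetric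

namespace PhiMetric

variable {X : Type*}

theorem exists_abs_d_sub_lt (M : PhiMetric X) (x : X) {ε : ℝ} (hε : 0 < ε) :
    ∃ δ > 0, ∀ y z, M.d y z < δ → |M.d x z - M.d x y| < ε := by
  obtain ⟨δ, hδ, h⟩ := M.phi_small (ε / 2) (half_pos hε)
  refine ⟨min δ (ε / 2), lt_min hδ (half_pos hε), fun y z hyz => ?_⟩
  obtain ⟨hyz₁, hyz₂⟩ := lt_min_iff.mp hyz
  have hsymm := M.d_symm z y
  have hz := M.d_triangle x z y
  have hy := M.d_triangle x y z
  have hphi_z := h x z y (Or.inr (hsymm ▸ hyz₁))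
  have hphi_y := h x y z (Or.inr hyz₁)
  rw [abs_lt]
  constructor <;> linarith

theorem isOpen_ball (M : PhiMetric X) (x : X) (r : ℝ) :
    IsOpen[M.toTopology] (M.ball x r) := by
  intro y hy
  have hy : M.d x y < r := hy
  obtain ⟨δ, hδ, h⟩ := M.exists_abs_d_sub_lt x (sub_pos.mpr hy)
  refine ⟨δ, hδ, fun z hz => ?_⟩
  have hz := (abs_lt.mp (h y z hz)).2
  change M.d x z < r
  linarith

theorem isOpen_setOf_lt_d (M : PhiMetric X) (x : X) (r : ℝ) :
    IsOpen[M.toTopology] {y | r < M.d x y} := by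
  intro y hy
  have hy : r < M.d x y := hy
  obtain ⟨δ, hδ, h⟩ := M.exists_abs_d_sub_lt x (sub_pos.mpr hy)
  refine ⟨δ, hδ, fun z hz => ?_⟩
  have hz := (abs_lt.mp (h y z hz)).1
  change r < M.d x z
  linarith

end PhiMetric

/-- every φ-metric space is regular. -/
theorem phiMetric_regular {X : Type*} [Nonempty X] (M : PhiMetric X)
    (A : Set X) (hA : IsClosed[M.toTopology] A) (x : X) (hx : x ∉ A) :
    ∃ U V : Set X, IsOpen[M.toTopology] U ∧ IsOpen[M.toTopology] V ∧
      A ⊆ U ∧ x ∈ V ∧ Disjoint U V := by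
  obtain ⟨r, hr, hball⟩ := hA.isOpen_compl x hx
  refine ⟨{y | r / 2 < M.d x y}, M.ball x (r / 2), M.isOpen_setOf_lt_d x _,
    M.isOpen_ball x _, fun a ha => ?_, ?_, ?_⟩
  · have hra : r ≤ M.d x a := not_lt.mp fun hlt => hball hlt ha
    exact (half_lt_self hr).trans_le hra
  · change M.d x x < r / 2
    rw [(M.d_eq_zero_iff x x).mpr rfl]
    exact half_pos hr
  · exact Set.disjoint_left.mpr fun y (hU : r / 2 < M.d x y) (hV : M.d x y < r / 2) =>
      lt_asymm hU hV
end

section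
/- Every φ-metric space (X, d_φ, φ) equipped with the topology τ_φ is normal: for every pair of disjoint τ_φ-closed sets A and B in X, there exist disjoint τ_φ-open sets U and V such that A ⊆ U and B ⊆ V. -/
open Filter Topology Set

namespace PhiMetric

variable {X : Type*} (M : PhiMetric X)

/-- The functions `d · z` are uniformly continuous, uniformly in `z`. -/
lemma exists_forall_d_lt_add {ε : ℝ} (hε : 0 < ε) :
    ∃ r > 0, ∀ x y z, M.d x y < r → M.d x z < M.d y z + ε := by
  obtain ⟨δ, hδ, h⟩ := M.phi_small (ε / 2) (half_pos hε)
  refine ⟨min δ (ε / 2), lt_min hδ (half_pos hε), fun x y z hxy => ?_⟩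
  have hφ := h x z y (Or.inl (hxy.trans_le (min_le_left _ _)))
  have hd := hxy.trans_le (min_le_right _ _)
  linarith [M.d_triangle x z y]

/-- The points strictly closer to `A` than to `B`. -/
def closerTo (A B : Set X) : Set X :=
  {x | ∃ a ∈ A, ∃ c, M.d x a < c ∧ ∀ b ∈ B, c ≤ M.d x b}

lemma isOpen_closerTo (A B : Set X) : IsOpen[M.toTopology] (M.closerTo A B) := by
  rintro x ⟨a, ha, c, hac, hc⟩
  obtain ⟨r, hr, h⟩ := M.exists_forall_d_lt_add (ε := (c - M.d x a) / 2) (by linarith)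
  refine ⟨r, hr, fun y (hy : M.d x y < r) => ⟨a, ha, c - (c - M.d x a) / 2, ?_, fun b hb => ?_⟩⟩
  · linarith [h y x a (M.d_symm x y ▸ hy)]
  · linarith [h x y b hy, hc b hb]

lemma subset_closerTo {A B : Set X} (hB : IsClosed[M.toTopology] B) (hAB : Disjoint A B) :
    A ⊆ M.closerTo A B := by
  intro a ha
  obtain ⟨r, hr, h⟩ := hB.isOpen_compl a (hAB.notMem_of_mem_left ha)
  refine ⟨a, ha, r, ((M.d_eq_zero_iff a a).2 rfl).trans_lt hr, fun b hb => ?_⟩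
  exact not_lt.1 fun hlt => h hlt hb

lemma disjoint_closerTo (A B : Set X) : Disjoint (M.closerTo A B) (M.closerTo B A) := by
  rw [Set.disjoint_left]
  rintro x ⟨a, ha, c, hac, hc⟩ ⟨b, hb, c', hbc, hc'⟩
  linarith [hc b hb, hc' a ha]

end PhiMetric

/-- every φ-metric space is normal. -/
theorem phiMetric_normal {X : Type*} [Nonempty X] (M : PhiMetric X)
    (A B : Set X) (hA : IsClosed[M.toTopology] A) (hB : IsClosed[M.toTopology] B)
    (hAB : Disjoint A B) :
    ∃ U V : Set X, IsOpen[M.toTopology] U ∧ IsOpen[M.toTopology] V ∧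
      A ⊆ U ∧ B ⊆ V ∧ Disjoint U V := by
  exact ⟨M.closerTo A B, M.closerTo B A, M.isOpen_closerTo A B, M.isOpen_closerTo B A,
    M.subset_closerTo hB hAB, M.subset_closerTo hA hAB.symm, M.disjoint_closerTo A B⟩
end

section
/- (Stone-type theorem) Let (X, d_φ, φ) be a φ-metric space with topology τ_φ. Then every open cover of X has an open refinement (a cover of X by τ_φ-open sets, each contained in some member of the original cover) which is both σ-locally finite and σ-discrete. -/
open Filter Topology Set

/-- A family of subsets is locally finite w.r.t. a topology `t`: every point has an
open neighborhood meeting only finitely many members of the family. -/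
def LocallyFiniteFamily {X : Type*} (t : TopologicalSpace X) (F : Set (Set X)) : Prop :=
  ∀ x : X, ∃ U : Set X, IsOpen[t] U ∧ x ∈ U ∧ {A ∈ F | (A ∩ U).Nonempty}.Finite

/-- A family of subsets is discrete w.r.t. a topology `t`: every point has an
open neighborhood meeting at most one member of the family. -/
def DiscreteFamily {X : Type*} (t : TopologicalSpace X) (F : Set (Set X)) : Prop :=
  ∀ x : X, ∃ U : Set X, IsOpen[t] U ∧ x ∈ U ∧ {A ∈ F | (A ∩ U).Nonempty}.Subsingleton

namespace PhiMetric

variable {X : Type*} (M : PhiMetric X)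

/-- A quantitative substitute for the triangle inequality. -/
theorem exists_d_lt_of_d_lt {ε : ℝ} (hε : 0 < ε) :
    ∃ δ > 0, ∀ x y z, M.d x z < δ → M.d z y < δ → M.d x y < ε := by
  obtain ⟨δ, hδ, h⟩ := M.phi_small (ε / 2) (half_pos hε)
  refine ⟨min δ (ε / 4), lt_min hδ (by positivity), fun x y z hxz hzy => ?_⟩
  have hphi := h x y z (Or.inl (hxz.trans_le (min_le_left _ _)))
  have hd := M.d_triangle x y z
  linarith [hxz.trans_le (min_le_right _ _), hzy.trans_le (min_le_right _ _)]

theorem comap_d_hasBasis :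
    (comap (fun p : X × X => M.d p.1 p.2) (𝓝 0)).HasBasis (fun ε : ℝ => 0 < ε)
      (fun ε => {p | M.d p.1 p.2 < ε}) := by
  refine (Metric.nhds_basis_ball.comap _).congr (fun _ => Iff.rfl) fun ε _ => ?_
  ext p
  simp [abs_of_nonneg (M.d_nonneg p.1 p.2)]

/-- The uniform structure of a φ-metric, with basis of entourages `{(x, y) | d x y < ε}`. -/
def uniformCore : UniformSpace.Core X where
  uniformity := comap (fun p : X × X => M.d p.1 p.2) (𝓝 0)
  refl := M.comap_d_hasBasis.ge_iff.2 fun ε hε => by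
    rintro ⟨x, y⟩ h
    obtain rfl : x = y := by simpa using h
    simpa [(M.d_eq_zero_iff x x).2 rfl] using hε
  symm := by
    refine tendsto_comap_iff.2 (tendsto_comap.congr fun p => ?_)
    exact M.d_symm p.1 p.2
  comp := M.comap_d_hasBasis.ge_iff.2 fun ε hε => by
    obtain ⟨δ, hδ, h⟩ := M.exists_d_lt_of_d_lt hε
    refine mem_of_superset (mem_lift' (M.comap_d_hasBasis.mem_of_mem hδ)) ?_
    rintro ⟨x, y⟩ ⟨z, hxz, hzy⟩
    exact h x y z hxz hzy

theorem toTopology_eq_uniformCore : M.toTopology = M.uniformCore.toTopologicalSpace := by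
  let u := UniformSpace.ofCore M.uniformCore
  refine TopologicalSpace.ext_iff.2 fun s => ?_
  refine Iff.trans ?_ (isOpen_uniformity (α := X)).symm
  refine forall₂_congr fun x _ => ?_
  refine Iff.trans ?_ M.comap_d_hasBasis.mem_iff.symm
  refine exists_congr fun r => and_congr_right fun _ => ⟨?_, fun h y hy => ?_⟩
  · rintro h ⟨a, b⟩ hab rfl
    exact h hab
  · exact h (show M.d (x, y).1 (x, y).2 < r from hy) rfl

theorem exists_pseudoMetricSpace_toTopology_eq :
    ∃ m : PseudoMetricSpace X, m.toUniformSpace.toTopologicalSpace = M.toTopology := by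
  let u := UniformSpace.ofCore M.uniformCore
  have : IsCountablyGenerated (uniformity X) :=
    inferInstanceAs (comap (fun p : X × X => M.d p.1 p.2) (𝓝 0)).IsCountablyGenerated
  exact ⟨UniformSpace.pseudoMetricSpace X, M.toTopology_eq_uniformCore.symm⟩

end PhiMetric

theorem DiscreteFamily.locallyFiniteFamily {X : Type*} {t : TopologicalSpace X}
    {F : Set (Set X)} (hF : DiscreteFamily t F) : LocallyFiniteFamily t F := fun x =>
  let ⟨U, hU, hxU, h⟩ := hF x
  ⟨U, hU, hxU, h.finite⟩

/-- The `ε`-thickenings of pairwise `4 * ε`-separated sets form a discrete family. -/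
theorem discreteFamily_range_thickening {X ι : Type*} [PseudoMetricSpace X] {T : ι → Set X}
    {ε : ℝ} (hε : 0 < ε)
    (hT : ∀ i j, i ≠ j → ∀ a ∈ T i, ∀ b ∈ T j, 4 * ε ≤ dist a b) :
    DiscreteFamily (inferInstance : TopologicalSpace X)
      (range fun i => Metric.thickening ε (T i)) := by
  refine fun x => ⟨Metric.ball x ε, Metric.isOpen_ball, Metric.mem_ball_self hε, ?_⟩
  rintro _ ⟨⟨i, rfl⟩, y, hy, hyx⟩ _ ⟨⟨j, rfl⟩, z, hz, hzx⟩
  obtain ⟨a, ha, hya⟩ := Metric.mem_thickening_iff.1 hy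
  obtain ⟨b, hb, hzb⟩ := Metric.mem_thickening_iff.1 hz
  by_cases hij : i = j
  · rw [hij]
  · have hab := hT i j hij a ha b hb
    have h₁ := dist_triangle4 a y x b
    have h₂ := dist_triangle x z b
    rw [dist_comm a y] at h₁
    rw [dist_comm x z] at h₂
    linarith [Metric.mem_ball.1 hyx, Metric.mem_ball.1 hzx]

/-- Stone's theorem: open covers of pseudometric spaces have σ-discrete open refinements. -/
theorem exists_sigmaDiscrete_refinement {X : Type*} [PseudoMetricSpace X] (𝒰 : Set (Set X))
    (hopen : ∀ U ∈ 𝒰, IsOpen U) (hcover : ⋃₀ 𝒰 = univ) :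
    ∃ g : ℕ → Set (Set X), (∀ n, ∀ V ∈ g n, IsOpen V ∧ ∃ U ∈ 𝒰, V ⊆ U) ∧
      ⋃₀ ⋃ n, g n = univ ∧
      ∀ n, DiscreteFamily (inferInstance : TopologicalSpace X) (g n) := by
  let ε : ℕ → ℝ := fun n => 1 / ((n : ℝ) + 1)
  have hε : ∀ n, 0 < ε n := fun n => Nat.one_div_pos_of_nat
  let T : ℕ → 𝒰 → Set X := fun n U =>
    {x | Metric.ball x (4 * ε n) ⊆ U ∧ ∀ V, WellOrderingRel V U → x ∉ (V : Set X)}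
  have hT : ∀ n U V, WellOrderingRel U V → ∀ a ∈ T n U, ∀ b ∈ T n V, 4 * ε n ≤ dist a b := by
    intro n U V hUV a ha b hb
    by_contra! h
    exact hb.2 U hUV (ha.1 (Metric.mem_ball'.2 h))
  refine ⟨fun n => range fun U => Metric.thickening (ε n) (T n U), ?_, ?_, ?_⟩
  · rintro n _ ⟨U, rfl⟩
    refine ⟨Metric.isOpen_thickening, U, U.2, fun y hy => ?_⟩
    obtain ⟨a, ha, hya⟩ := Metric.mem_thickening_iff.1 hy
    exact ha.1 (Metric.mem_ball.2 (by linarith [hε n]))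
  · refine eq_univ_of_forall fun x => ?_
    have hx : {U : 𝒰 | x ∈ (U : Set X)}.Nonempty := by
      obtain ⟨U, hU, hxU⟩ := mem_sUnion.1 (hcover ▸ mem_univ x)
      exact ⟨⟨U, hU⟩, hxU⟩
    obtain ⟨U, hxU, hmin⟩ := WellOrderingRel.isWellOrder.wf.has_min _ hx
    obtain ⟨r, hr, hball⟩ := Metric.isOpen_iff.1 (hopen U U.2) x hxU
    obtain ⟨n, hn⟩ := exists_nat_one_div_lt (show 0 < r / 4 by positivity)
    have hnr : 4 * ε n ≤ r := by
      have : ε n < r / 4 := hn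
      linarith
    exact mem_sUnion.2 ⟨_, mem_iUnion.2 ⟨n, U, rfl⟩, Metric.self_subset_thickening (hε n) _
      ⟨(Metric.ball_subset_ball hnr).trans hball, fun V hV hxV => hmin V hxV hV⟩⟩
  · refine fun n => discreteFamily_range_thickening (hε n) fun U V hUV a ha b hb => ?_
    rcases (trichotomous_of WellOrderingRel U V) with h | h | h
    · exact hT n U V h a ha b hb
    · exact absurd h hUV
    · exact dist_comm a b ▸ hT n V U h b hb a ha

/-- Stone-type theorem: every open cover of a φ-metric space has an
open refinement which is both σ-locally finite and σ-discrete. -/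
theorem phiMetric_stone {X : Type*} [Nonempty X] (M : PhiMetric X)
    (𝒰 : Set (Set X)) (h𝒰open : ∀ U ∈ 𝒰, IsOpen[M.toTopology] U)
    (h𝒰cover : ⋃₀ 𝒰 = Set.univ) :
    ∃ 𝒱 : Set (Set X),
      (∀ V ∈ 𝒱, IsOpen[M.toTopology] V) ∧
      ⋃₀ 𝒱 = Set.univ ∧
      (∀ V ∈ 𝒱, ∃ U ∈ 𝒰, V ⊆ U) ∧
      (∃ f : ℕ → Set (Set X), 𝒱 = ⋃ n, f n ∧
        ∀ n, LocallyFiniteFamily M.toTopology (f n)) ∧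
      (∃ g : ℕ → Set (Set X), 𝒱 = ⋃ n, g n ∧
        ∀ n, DiscreteFamily M.toTopology (g n)) := by
  obtain ⟨m, hm⟩ := M.exists_pseudoMetricSpace_toTopology_eq
  rw [← hm] at h𝒰open ⊢
  obtain ⟨g, hg, hcover, hdiscrete⟩ := exists_sigmaDiscrete_refinement 𝒰 h𝒰open h𝒰cover
  refine ⟨⋃ n, g n, fun V hV => ?_, hcover, fun V hV => ?_,
    ⟨g, rfl, fun n => (hdiscrete n).locallyFiniteFamily⟩, g, rfl, hdiscrete⟩
  all_goals obtain ⟨n, hn⟩ := mem_iUnion.1 hV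
  · exact (hg n V hn).1
  · exact (hg n V hn).2
end

section
/- Let (X, d_φ, φ) be a φ-metric space with topology τ_φ. Then X has a σ-discrete base: there is a base B of τ_φ that is a countable union of discrete families. -/
open Filter Topology Set

namespace PhiMetric

variable {X : Type*}

/-- The filter of sets `{(x, y) | d x y < r}`, `r > 0`, generating the uniformity of `M`. -/
def uniformityFilter (M : PhiMetric X) : Filter (X × X) :=
  comap (fun p => M.d p.1 p.2) (𝓝 0)

theorem hasBasis_uniformityFilter (M : PhiMetric X) :
    M.uniformityFilter.HasBasis (fun r : ℝ => 0 < r) fun r => {p | M.d p.1 p.2 < r} := by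
  refine (Metric.nhds_basis_ball.comap _).congr (fun _ => Iff.rfl) fun r _ => ?_
  ext p
  simp [abs_of_nonneg (M.d_nonneg _ _)]

theorem exists_forall_lt_of_lt_of_lt (M : PhiMetric X) {ε : ℝ} (hε : 0 < ε) :
    ∃ δ > 0, ∀ x y z, M.d x z < δ → M.d z y < δ → M.d x y < ε := by
  obtain ⟨δ, hδ, h⟩ := M.phi_small (ε / 3) (by positivity)
  refine ⟨min δ (ε / 3), lt_min hδ (by positivity), fun x y z hxz hzy => ?_⟩
  have := M.d_triangle x y z
  have := h x y z (.inl (hxz.trans_le (min_le_left _ _)))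
  have := hxz.trans_le (min_le_right _ _)
  have := hzy.trans_le (min_le_right _ _)
  linarith

/-- The uniform structure generated by a φ-metric. -/
@[reducible]
def toUniformSpace (M : PhiMetric X) : UniformSpace X :=
  .ofCore
    { uniformity := M.uniformityFilter
      refl := by
        refine M.hasBasis_uniformityFilter.ge_iff.2 fun r hr => ?_
        rintro ⟨x, y⟩ (rfl : x = y)
        simpa [(M.d_eq_zero_iff x x).2 rfl] using hr
      symm := by
        refine M.hasBasis_uniformityFilter.tendsto_right_iff.2 fun r hr => ?_
        filter_upwards [M.hasBasis_uniformityFilter.mem_of_mem hr] with p hp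
        simpa [M.d_symm p.2 p.1] using hp
      comp := by
        refine M.hasBasis_uniformityFilter.ge_iff.2 fun r hr => ?_
        obtain ⟨δ, hδ, h⟩ := M.exists_forall_lt_of_lt_of_lt hr
        refine mem_of_superset
          (mem_lift' (M.hasBasis_uniformityFilter.mem_of_mem hδ)) ?_
        rintro ⟨x, y⟩ ⟨z, hxz, hzy⟩
        exact h x y z hxz hzy }

theorem toTopology_eq (M : PhiMetric X) :
    M.toTopology = M.toUniformSpace.toTopologicalSpace := by
  let := M.toUniformSpace
  refine TopologicalSpace.ext_iff.2 fun G => ?_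
  refine Iff.trans ?_ isOpen_iff_mem_nhds.symm
  refine forall₂_congr fun x _ => ?_
  exact ((nhds_basis_uniformity' M.hasBasis_uniformityFilter).mem_iff).symm

theorem pseudoMetrizableSpace (M : PhiMetric X) :
    @TopologicalSpace.PseudoMetrizableSpace X M.toTopology := by
  let := M.toUniformSpace
  have : IsCountablyGenerated (uniformity X) :=
    inferInstanceAs (IsCountablyGenerated (comap _ (𝓝 (0 : ℝ))))
  rw [toTopology_eq]
  infer_instance

end PhiMetric

section SigmaDiscrete

variable {X : Type*} [PseudoMetricSpace X]

/-- A member of a discrete refinement of the cover by balls of radius `r`: the `ε`-neighbourhood of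
the set of points `x` such that `Metric.ball i r` is the first ball containing `x` and it contains
`Metric.ball x (3 * ε)`. -/
def discreteRefinement [LT X] (r ε : ℝ) (i : X) : Set X :=
  ⋃ x ∈ {x : X | Metric.ball x (3 * ε) ⊆ Metric.ball i r ∧ ∀ j < i, x ∉ Metric.ball j r},
    Metric.ball x ε

theorem mem_discreteRefinement [LT X] {r ε : ℝ} {i y : X} :
    y ∈ discreteRefinement r ε i ↔ ∃ x, (Metric.ball x (3 * ε) ⊆ Metric.ball i r ∧
      ∀ j < i, x ∉ Metric.ball j r) ∧ dist y x < ε := by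
  simp [discreteRefinement]

theorem isOpen_discreteRefinement [LT X] (r ε : ℝ) (i : X) :
    IsOpen (discreteRefinement r ε i) :=
  isOpen_biUnion fun _ _ => Metric.isOpen_ball

theorem discreteRefinement_subset_ball [LT X] {r ε : ℝ} (hε : 0 < ε) (i : X) :
    discreteRefinement r ε i ⊆ Metric.ball i r := by
  intro y hy
  obtain ⟨x, ⟨hx, -⟩, hyx⟩ := mem_discreteRefinement.1 hy
  exact hx (Metric.mem_ball.2 (by linarith))

theorem exists_mem_discreteRefinement [LT X] [WellFoundedLT X] {r : ℝ} (hr : 0 < r) (x : X) :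
    ∃ n : ℕ, ∃ i, x ∈ discreteRefinement r (1 / (n + 1)) i := by
  have hne : {i | x ∈ Metric.ball i r}.Nonempty := ⟨x, Metric.mem_ball_self hr⟩
  obtain ⟨i, hi, hmin⟩ := (wellFounded_lt (α := X)).has_min _ hne
  obtain ⟨ε, hε, hball⟩ := Metric.isOpen_iff.1 Metric.isOpen_ball x hi
  obtain ⟨n, hn⟩ := exists_nat_one_div_lt (show 0 < ε / 3 by positivity)
  refine ⟨n, i, mem_discreteRefinement.2 ⟨x, ⟨?_, fun j hj hxj => hmin j hxj hj⟩, ?_⟩⟩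
  · exact (Metric.ball_subset_ball (by linarith)).trans hball
  · rw [dist_self]
    positivity

theorem le_dist_of_mem_discreteRefinement [LT X] {r ε : ℝ} {i j y z : X}
    (hij : i < j) (hy : y ∈ discreteRefinement r ε i) (hz : z ∈ discreteRefinement r ε j) :
    ε ≤ dist y z := by
  obtain ⟨y', ⟨hy', -⟩, hyy'⟩ := mem_discreteRefinement.1 hy
  obtain ⟨z', ⟨-, hz'⟩, hzz'⟩ := mem_discreteRefinement.1 hz
  by_contra! h
  refine hz' i hij (hy' (Metric.mem_ball.2 ?_))
  have := dist_triangle4 z' z y y'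
  rw [dist_comm z' z, dist_comm z y] at this
  linarith

theorem discreteFamily_range_discreteRefinement [LinearOrder X] (r : ℝ) {ε : ℝ} (hε : 0 < ε) :
    DiscreteFamily inferInstance (range (discreteRefinement r ε : X → Set X)) := by
  refine fun x => ⟨Metric.ball x (ε / 2), Metric.isOpen_ball,
    Metric.mem_ball_self (by positivity), ?_⟩
  rintro _ ⟨⟨i, rfl⟩, y, hyi, hyx⟩ _ ⟨⟨j, rfl⟩, z, hzj, hzx⟩
  have hlt : dist y z < ε := by
    have := dist_triangle_right y z x
    rw [Metric.mem_ball] at hyx hzx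
    linarith
  rcases lt_trichotomy i j with h | rfl | h
  · exact absurd (le_dist_of_mem_discreteRefinement h hyi hzj) hlt.not_ge
  · rfl
  · exact absurd (le_dist_of_mem_discreteRefinement h hzj hyi) (dist_comm y z ▸ hlt.not_ge)

end SigmaDiscrete

/-- Every pseudometrizable space has a σ-discrete base. -/
theorem exists_sigmaDiscrete_isTopologicalBasis (X : Type*) [t : TopologicalSpace X]
    [TopologicalSpace.PseudoMetrizableSpace X] :
    ∃ g : ℕ → Set (Set X), TopologicalSpace.IsTopologicalBasis (⋃ n, g n) ∧
      ∀ n, DiscreteFamily t (g n) := by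
  let := TopologicalSpace.pseudoMetrizableSpacePseudoMetric X
  obtain ⟨_, _⟩ := exists_wellFoundedLT X
  refine ⟨fun n => range (discreteRefinement (1 / (n.unpair.1 + 1)) (1 / (n.unpair.2 + 1))),
    TopologicalSpace.isTopologicalBasis_of_isOpen_of_nhds ?_ fun x U hx hU => ?_,
    fun n => discreteFamily_range_discreteRefinement _ (by positivity)⟩
  · intro _ hs
    obtain ⟨n, i, rfl⟩ := mem_iUnion.1 hs
    exact isOpen_discreteRefinement _ _ _
  obtain ⟨ε, hε, hball⟩ := Metric.isOpen_iff.1 hU x hx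
  obtain ⟨k, hk⟩ := exists_nat_one_div_lt (half_pos hε)
  obtain ⟨n, i, hi⟩ := exists_mem_discreteRefinement (r := 1 / ((k : ℝ) + 1)) (by positivity) x
  refine ⟨_, mem_iUnion.2 ⟨Nat.pair k n, i, rfl⟩, by simpa using hi, fun y hy => hball ?_⟩
  have hyi := discreteRefinement_subset_ball (by positivity) i hy
  have hxi := discreteRefinement_subset_ball (by positivity) i hi
  simp only [Nat.unpair_pair, Metric.mem_ball] at hyi hxi ⊢
  linarith [dist_triangle_right y x i]

/-- every φ-metric space has a σ-discrete base. -/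
theorem phiMetric_sigmaDiscrete_base {X : Type*} [Nonempty X] (M : PhiMetric X) :
    ∃ B : Set (Set X), @TopologicalSpace.IsTopologicalBasis X M.toTopology B ∧
      ∃ g : ℕ → Set (Set X), B = ⋃ n, g n ∧
        ∀ n, DiscreteFamily M.toTopology (g n) := by
  let := M.toTopology
  have := M.pseudoMetrizableSpace
  obtain ⟨g, hg, hd⟩ := exists_sigmaDiscrete_isTopologicalBasis X
  exact ⟨_, hg, g, rfl, hd⟩
end

section
/- Let (X, d_φ, φ) be a φ-metric space. Then the topology τ_φ is Hausdorff: for any two distinct points x, y ∈ X there exist disjoint τ_φ-open sets U and V with x ∈ U and y ∈ V. In particular, every sequence in X that converges in τ_φ has a unique limit. -/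
open Filter Topology Set

namespace PhiMetric

variable {X : Type*}

theorem mem_ball_self (M : PhiMetric X) (x : X) {r : ℝ} (hr : 0 < r) : x ∈ M.ball x r := by
  show M.d x x < r
  rwa [(M.d_eq_zero_iff x x).2 rfl]

theorem exists_disjoint_ball (M : PhiMetric X) {x y : X} (hxy : x ≠ y) :
    ∃ r > 0, Disjoint (M.ball x r) (M.ball y r) := by
  have hpos : 0 < M.d x y :=
    (M.d_nonneg x y).lt_of_ne fun h => hxy ((M.d_eq_zero_iff x y).1 h.symm)
  obtain ⟨δ, hδ, hphi⟩ := M.phi_small (M.d x y / 3) (by linarith)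
  refine ⟨min δ (M.d x y / 3), lt_min hδ (by linarith), Set.disjoint_left.2 fun w hx hy => ?_⟩
  obtain ⟨hx₁, hx₂⟩ := lt_min_iff.1 (show M.d x w < _ from hx)
  obtain ⟨-, hy₂⟩ := lt_min_iff.1 (show M.d y w < _ from hy)
  have hsmall := hphi x y w (Or.inl hx₁)
  have htri := M.d_triangle x y w
  rw [M.d_symm w y] at htri
  linarith

end PhiMetric

/-- τ_φ is Hausdorff; in particular limits of sequences are unique. -/
theorem phiMetric_hausdorff {X : Type*} [Nonempty X] (M : PhiMetric X) :
    (∀ x y : X, x ≠ y → ∃ U V : Set X, IsOpen[M.toTopology] U ∧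
      IsOpen[M.toTopology] V ∧ x ∈ U ∧ y ∈ V ∧ Disjoint U V) ∧
    (∀ (u : ℕ → X) (x y : X),
      Filter.Tendsto (fun n => M.d (u n) x) Filter.atTop (nhds 0) →
      Filter.Tendsto (fun n => M.d (u n) y) Filter.atTop (nhds 0) → x = y) := by
  refine ⟨fun x y hxy => ?_, fun u x y hx hy => ?_⟩
  · obtain ⟨r, hr, hdisj⟩ := M.exists_disjoint_ball hxy
    exact ⟨M.ball x r, M.ball y r, M.isOpen_ball x r, M.isOpen_ball y r,
      M.mem_ball_self x hr, M.mem_ball_self y hr, hdisj⟩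
  · by_contra hxy
    obtain ⟨r, hr, hdisj⟩ := M.exists_disjoint_ball hxy
    obtain ⟨n, hnx, hny⟩ := ((hx.eventually_lt_const hr).and (hy.eventually_lt_const hr)).exists
    rw [M.d_symm] at hnx hny
    exact Set.disjoint_left.1 hdisj hnx hny
end

section
/- Let (X, d_φ, φ) be a φ-metric space and let (x_n) and (y_n) be sequences in X with d_φ(x_n, x) → 0 and d_φ(y_n, y) → 0 as n → ∞ for some x, y ∈ X. Then the real sequence (d_φ(x_n, y_n)) converges to d_φ(x, y). -/
open Filter Topology Set

/-- A φ-metric is uniformly continuous in its first argument, uniformly in the second. -/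
theorem PhiMetric.exists_abs_d_sub_d_lt {X : Type*} (M : PhiMetric X) {ε : ℝ} (hε : 0 < ε) :
    ∃ δ : ℝ, 0 < δ ∧ ∀ u w v, M.d u w < δ → |M.d u v - M.d w v| < ε := by
  obtain ⟨δ, hδ, h⟩ := M.phi_small (ε / 2) (half_pos hε)
  refine ⟨min δ (ε / 2), lt_min hδ (half_pos hε), fun u w v huw => ?_⟩
  obtain ⟨hlt, hlt_half⟩ := lt_min_iff.mp huw
  have hwu := M.d_symm w u
  have phi_uw := h u v w (Or.inl hlt)
  have phi_wu := h w v u (Or.inl (hwu ▸ hlt))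
  have tri_uw := M.d_triangle u v w
  have tri_wu := M.d_triangle w v u
  rw [abs_sub_lt_iff]
  constructor <;> linarith

/-- if `x_n → x` and `y_n → y` then `d_φ(x_n, y_n) → d_φ(x, y)`. -/
theorem phiMetric_dist_tendsto {X : Type*} [Nonempty X] (M : PhiMetric X)
    (x y : ℕ → X) (a b : X)
    (hx : Filter.Tendsto (fun n => M.d (x n) a) Filter.atTop (nhds 0))
    (hy : Filter.Tendsto (fun n => M.d (y n) b) Filter.atTop (nhds 0)) :
    Filter.Tendsto (fun n => M.d (x n) (y n)) Filter.atTop (nhds (M.d a b)) := by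
  rw [Metric.tendsto_nhds]
  intro ε hε
  obtain ⟨δ, hδ, h⟩ := M.exists_abs_d_sub_d_lt (half_pos hε)
  filter_upwards [hx.eventually_lt_const hδ, hy.eventually_lt_const hδ] with n hxn hyn
  have hleft := h (x n) a (y n) hxn
  have hright := h (y n) b a hyn
  rw [M.d_symm (y n) a, M.d_symm b a] at hright
  rw [Real.dist_eq]
  linarith [abs_sub_le (M.d (x n) (y n)) (M.d a (y n)) (M.d a b)]
end

section
/- Let (X, d_φ, φ) be a φ-metric space and A ⊆ X. Then the diameter of the closure of A (taken in the topology τ_φ) equals the diameter of A: sup{d_φ(x,y) : x, y ∈ cl(A)} = sup{d_φ(x,y) : x, y ∈ A}, where the suprema are taken in [0, ∞]. -/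
open Filter Topology Set

/-- Closed balls of a φ-metric are closed in the topology it generates. -/
theorem PhiMetric.isClosed_setOf_d_le {X : Type*} (M : PhiMetric X) (y : X) (r : ℝ) :
    IsClosed[M.toTopology] {x | M.d x y ≤ r} := by
  refine @IsClosed.mk X M.toTopology _ fun x hx => ?_
  have hx : r < M.d x y := not_le.mp hx
  obtain ⟨δ, hδ, hφ⟩ := M.phi_small ((M.d x y - r) / 2) (by linarith)
  refine ⟨min δ ((M.d x y - r) / 2), lt_min hδ (by linarith), fun z hz => ?_⟩
  obtain ⟨hzδ, hzr⟩ := lt_min_iff.mp (show M.d x z < min _ _ from hz)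
  refine mem_compl fun hzy : M.d z y ≤ r => ?_
  linarith [hφ x y z (Or.inl hzδ), M.d_triangle x y z]

/-- A bound on the distances between points of `A` and `B` extends to their closures. -/
theorem PhiMetric.d_le_of_mem_closure {X : Type*} (M : PhiMetric X) {A B : Set X} {r : ℝ}
    (h : ∀ x ∈ A, ∀ y ∈ B, M.d x y ≤ r) {x y : X}
    (hx : x ∈ @closure X M.toTopology A) (hy : y ∈ @closure X M.toTopology B) :
    M.d x y ≤ r := by
  let := M.toTopology
  have hxB (b : X) (hb : b ∈ B) : M.d x b ≤ r :=
    closure_minimal (fun a ha => h a ha b hb) (M.isClosed_setOf_d_le b r) hx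
  rw [M.d_symm]
  refine closure_minimal (fun b hb => ?_) (M.isClosed_setOf_d_le x r) hy
  exact (M.d_symm b x).trans_le (hxB b hb)

/-- the diameter of the closure of a set equals the diameter of the set. -/
theorem phiMetric_diam_closure {X : Type*} [Nonempty X] (M : PhiMetric X) (A : Set X) :
    (⨆ x ∈ @closure X M.toTopology A, ⨆ y ∈ @closure X M.toTopology A,
        ENNReal.ofReal (M.d x y)) =
      ⨆ x ∈ A, ⨆ y ∈ A, ENNReal.ofReal (M.d x y) := by
  let := M.toTopology
  apply le_antisymm
  · simp only [iSup_le_iff]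
    intro x hx y hy
    set D := ⨆ x ∈ A, ⨆ y ∈ A, ENNReal.ofReal (M.d x y)
    rcases eq_or_ne D ⊤ with htop | hfin
    · simp [htop]
    rw [ENNReal.ofReal_le_iff_le_toReal hfin]
    refine M.d_le_of_mem_closure (fun a ha b hb => ?_) hx hy
    rw [← ENNReal.ofReal_le_iff_le_toReal hfin]
    exact le_iSup₂_of_le a ha (le_iSup₂_of_le b hb le_rfl)
  · simp only [iSup_le_iff]
    intro x hx y hy
    exact le_iSup₂_of_le x (subset_closure hx) (le_iSup₂_of_le y (subset_closure hy) le_rfl)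
end

section
/- Let (X, d_φ, φ) be a totally bounded φ-metric space. Then every sequence in X has a Cauchy subsequence. -/
open Filter Topology Set

namespace PhiMetric

/-- Two points close enough to a common third point are close to each other. -/
theorem exists_forall_d_lt {X : Type*} (M : PhiMetric X) {ε : ℝ} (hε : 0 < ε) :
    ∃ δ : ℝ, 0 < δ ∧ ∀ a x y, M.d a x < δ → M.d a y < δ → M.d x y < ε := by
  obtain ⟨δ, hδ, h⟩ := M.phi_small (ε / 3) (by positivity)
  refine ⟨min δ (ε / 3), lt_min hδ (by positivity), fun a x y hx hy => ?_⟩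
  rw [lt_min_iff] at hx hy
  rw [M.d_symm a x] at hx
  linarith [M.d_triangle x y a, h x y a (Or.inl hx.1)]

/-- In a totally bounded φ-metric space, an ultrafilter-generic term of a sequence lies in some
ball of any prescribed radius. -/
theorem exists_eventually_d_lt {X : Type*} (M : PhiMetric X)
    (htb : ∀ ε : ℝ, 0 < ε → ∃ A : Finset X, (Set.univ : Set X) = ⋃ a ∈ A, M.ball a ε)
    {ι : Type*} (l : Ultrafilter ι) (u : ι → X) {ε : ℝ} (hε : 0 < ε) :
    ∃ a, ∀ᶠ i in (l : Filter ι), M.d a (u i) < ε := by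
  obtain ⟨A, hA⟩ := htb ε hε
  have hmem : (⋃ a ∈ (A : Set X), M.ball a ε) ∈ l.map u := by
    rw [show (⋃ a ∈ (A : Set X), M.ball a ε) = Set.univ from hA.symm]
    exact Filter.univ_mem
  obtain ⟨a, -, ha⟩ := (Ultrafilter.finite_biUnion_mem_iff A.finite_toSet).1 hmem
  exact ⟨a, ha⟩

end PhiMetric

/-- in a totally bounded φ-metric space, every sequence has a Cauchy
subsequence. -/
theorem phiMetric_totallyBounded_cauchy_subseq {X : Type*} [Nonempty X] (M : PhiMetric X)
    (htb : ∀ ε : ℝ, 0 < ε → ∃ A : Finset X, (Set.univ : Set X) = ⋃ a ∈ A, M.ball a ε)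
    (u : ℕ → X) :
    ∃ φ : ℕ → ℕ, StrictMono φ ∧ M.IsCauchySeq (u ∘ φ) := by
  have hpos : ∀ k : ℕ, (0 : ℝ) < 1 / ((k : ℝ) + 1) := fun k => Nat.one_div_pos_of_nat
  choose a ha using fun k : ℕ => M.exists_eventually_d_lt htb (hyperfilter ℕ) u (hpos k)
  have hfreq : ∀ k : ℕ, ∃ᶠ n in atTop, ∀ j ≤ k, M.d (a j) (u n) < 1 / ((j : ℝ) + 1) := by
    intro k
    have hev : ∀ᶠ n in (hyperfilter ℕ : Filter ℕ), ∀ j ∈ Set.Iic k,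
        M.d (a j) (u n) < 1 / ((j : ℝ) + 1) :=
      (eventually_all_finite (Set.finite_Iic k)).2 fun j _ => ha j
    exact hev.frequently.filter_mono Nat.hyperfilter_le_atTop
  obtain ⟨φ, hφ, hd⟩ := extraction_forall_of_frequently hfreq
  refine ⟨φ, hφ, fun ε hε => ?_⟩
  obtain ⟨δ, hδ, hclose⟩ := M.exists_forall_d_lt hε
  obtain ⟨j, hj⟩ := exists_nat_one_div_lt hδ
  exact ⟨j, fun m hm n hn =>
    hclose (a j) _ _ ((hd m j hm).trans hj) ((hd n j hn).trans hj)⟩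
end

section
/- (Banach-type contraction principle) Let (X, d_φ, φ) be a complete φ-metric space and let T : X → X satisfy d_φ(Tx, Ty) ≤ k · d_φ(x, y) for all x, y ∈ X, where k ∈ (0,1). Then T has a unique fixed point in X. -/
open Filter Topology Set

namespace PhiMetric

variable {X : Type*}

/-- The Picard iterates of a contraction form a Cauchy sequence. -/
theorem isCauchySeq_iterate (M : PhiMetric X) {T : X → X} {k : ℝ} (hk0 : 0 ≤ k) (hk1 : k < 1)
    (hT : ∀ x y : X, M.d (T x) (T y) ≤ k * M.d x y) (x : X) :
    M.IsCauchySeq fun n => T^[n] x := by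
  have hstep : ∀ n, M.d (T^[n] x) (T^[n + 1] x) ≤ k ^ n * M.d x (T x) := by
    intro n
    induction n with
    | zero => simp
    | succ n ih =>
      rw [Function.iterate_succ_apply' T n, Function.iterate_succ_apply' T (n + 1), pow_succ',
        mul_assoc]
      exact (hT _ _).trans (mul_le_mul_of_nonneg_left ih hk0)
  have hlim : Tendsto (fun n => k ^ n * M.d x (T x)) atTop (𝓝 0) := by
    simpa using (tendsto_pow_atTop_nhds_zero_of_lt_one hk0 hk1).mul_const (M.d x (T x))
  intro ε hε
  have hη : 0 < (1 - k) * ε / 2 := by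
    have : 0 < 1 - k := sub_pos.2 hk1
    positivity
  obtain ⟨δ, hδ, hphi⟩ := M.phi_small _ hη
  obtain ⟨N, hN⟩ := eventually_atTop.1 (hlim.eventually_lt_const (lt_min hδ hη))
  have hclose : ∀ p, ∀ n ≥ N, M.d (T^[n] x) (T^[n + p] x) < ε := by
    intro p
    induction p with
    | zero =>
      intro n _
      rwa [add_zero, (M.d_eq_zero_iff _ _).2 rfl]
    | succ p ih =>
      intro n hn
      have hsmall := (hstep n).trans_lt (hN n hn)
      have htri := M.d_triangle (T^[n] x) (T^[n + (p + 1)] x) (T^[n + 1] x)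
      have hφ := hphi (T^[n] x) (T^[n + (p + 1)] x) (T^[n + 1] x)
        (.inl (hsmall.trans_le (min_le_left _ _)))
      have hcontr : M.d (T^[n + 1] x) (T^[n + (p + 1)] x) ≤ k * ε := by
        rw [← add_assoc, Function.iterate_succ_apply', Function.iterate_succ_apply']
        exact (hT _ _).trans (mul_le_mul_of_nonneg_left (ih n hn).le hk0)
      linarith [hsmall.trans_le (min_le_right _ _)]
  refine ⟨N, fun m hm n hn => ?_⟩
  rcases le_total m n with h | h
  · obtain ⟨p, rfl⟩ := Nat.exists_eq_add_of_le h
    exact hclose p m hm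
  · obtain ⟨p, rfl⟩ := Nat.exists_eq_add_of_le h
    rw [M.d_symm]
    exact hclose p n hn

/-- Limits in a φ-metric space are unique. -/
theorem eq_of_tendsto (M : PhiMetric X) {u : ℕ → X} {a b : X}
    (ha : Tendsto (fun n => M.d (u n) a) atTop (𝓝 0))
    (hb : Tendsto (fun n => M.d (u n) b) atTop (𝓝 0)) : a = b := by
  refine (M.d_eq_zero_iff a b).1 (le_antisymm (le_of_forall_pos_lt_add fun ε hε => ?_)
    (M.d_nonneg a b))
  obtain ⟨δ, hδ, hphi⟩ := M.phi_small (ε / 3) (by positivity)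
  have hη : 0 < min δ (ε / 3) := lt_min hδ (by positivity)
  obtain ⟨n, hna, hnb⟩ := ((ha.eventually_lt_const hη).and (hb.eventually_lt_const hη)).exists
  have htri := M.d_triangle a b (u n)
  rw [M.d_symm] at hna
  have hφ := hphi a b (u n) (.inl (hna.trans_le (min_le_left _ _)))
  linarith [hna.trans_le (min_le_right _ _), hnb.trans_le (min_le_right _ _)]

end PhiMetric

/-- Banach-type contraction principle: a contraction on a complete
φ-metric space has a unique fixed point. -/
theorem phiMetric_banach {X : Type*} [Nonempty X] (M : PhiMetric X)
    (hX : M.Complete) (T : X → X) (k : ℝ) (hk0 : 0 < k) (hk1 : k < 1)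
    (hT : ∀ x y : X, M.d (T x) (T y) ≤ k * M.d x y) :
    ∃! z : X, T z = z := by
  obtain ⟨x⟩ := ‹Nonempty X›
  obtain ⟨a, ha⟩ := hX _ (M.isCauchySeq_iterate hk0.le hk1 hT x)
  have hTa : Tendsto (fun n => M.d (T^[n + 1] x) (T a)) atTop (𝓝 0) := by
    refine squeeze_zero (fun n => M.d_nonneg _ _) (fun n => ?_)
      (by simpa using ha.const_mul k : Tendsto (fun n => k * M.d (T^[n] x) a) atTop (𝓝 0))
    rw [Function.iterate_succ_apply']
    exact hT _ _
  have hfix : T a = a := M.eq_of_tendsto hTa (ha.comp (tendsto_add_atTop_nat 1))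
  refine ⟨a, hfix, fun y (hy : T y = y) => (M.d_eq_zero_iff y a).1 ?_⟩
  have h := hT y a
  rw [hy, hfix] at h
  nlinarith [M.d_nonneg y a]
end
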